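/- For any i ∈ [n−2], we have t_{i+2} (t_i − 1) = (t_i − 1)(t_{i+1} − 1) in k[S_n]. -/

import Mathlib

/-- The simple transposition `s_i ∈ S_n` (1-based indexing), swapping `i` and `i+1`,
defined as the identity for `i` outside `{1, …, n-1}`. -/
def simpleTransposition (n i : ℕ) : Equiv.Perm (Fin n) :=
  if h : 1 ≤ i ∧ i < n then
    Equiv.swap ⟨i - 1, by omega⟩ ⟨i, h.2⟩
  else 1

/-- The cycle `(v ⟹ w) = s_v s_{v+1} ⋯ s_{w-1} ∈ S_n`, sending
`v ↦ v+1 ↦ ⋯ ↦ w ↦ v` (and equal to the identity when `v = w`). -/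
def cyc (n v w : ℕ) : Equiv.Perm (Fin n) :=
  ((List.range' v (w - v)).map (simpleTransposition n)).prod

/-- The somewhere-to-below shuffle `t_ℓ = Σ_{w=ℓ}^{n} (ℓ ⟹ w)` in the group
algebra `R[S_n]`. -/
noncomputable def t (R : Type*) [CommRing R] (n ℓ : ℕ) :
    MonoidAlgebra R (Equiv.Perm (Fin n)) :=
  ∑ w ∈ Finset.Icc ℓ n, MonoidAlgebra.of R (Equiv.Perm (Fin n)) (cyc n ℓ w)

theorem simpleTransposition_mul_self (n i : ℕ) :
    simpleTransposition n i * simpleTransposition n i = 1 := by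
  unfold simpleTransposition
  split_ifs <;> simp

theorem simpleTransposition_commute (n : ℕ) {i j : ℕ} (hij : i + 2 ≤ j) :
    Commute (simpleTransposition n i) (simpleTransposition n j) := by
  unfold simpleTransposition
  split_ifs
  · refine (Equiv.Perm.disjoint_iff_disjoint_support.2 ?_).commute
    rw [Equiv.Perm.support_swap (by simp only [ne_eq, Fin.mk.injEq]; omega),
      Equiv.Perm.support_swap (by simp only [ne_eq, Fin.mk.injEq]; omega)]
    simp only [Finset.disjoint_insert_left, Finset.disjoint_singleton_left, Finset.mem_insert,
      Finset.mem_singleton, Fin.mk.injEq]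
    omega
  all_goals simp

theorem simpleTransposition_braid (n : ℕ) {i : ℕ} (hi : 1 ≤ i) (hin : i + 1 < n) :
    simpleTransposition n i * simpleTransposition n (i + 1) * simpleTransposition n i =
      simpleTransposition n (i + 1) * simpleTransposition n i *
        simpleTransposition n (i + 1) := by
  have hs : simpleTransposition n i = Equiv.swap ⟨i - 1, by omega⟩ ⟨i, by omega⟩ :=
    dif_pos ⟨hi, by omega⟩
  have hr : simpleTransposition n (i + 1) = Equiv.swap ⟨i, by omega⟩ ⟨i + 1, hin⟩ :=
    dif_pos ⟨by omega, hin⟩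
  rw [hs, hr]
  generalize ha : (⟨i - 1, _⟩ : Fin n) = a
  generalize hb : (⟨i, _⟩ : Fin n) = b
  generalize hc : (⟨i + 1, _⟩ : Fin n) = c
  have hab : a ≠ b := by simp only [← ha, ← hb, ne_eq, Fin.mk.injEq]; omega
  have hac : a ≠ c := by simp only [← ha, ← hc, ne_eq, Fin.mk.injEq]; omega
  have hbc : b ≠ c := by simp only [← hb, ← hc, ne_eq, Fin.mk.injEq]; omega
  rw [Equiv.swap_mul_swap_mul_swap hab hac, Equiv.swap_comm a b, Equiv.swap_comm b c,
    Equiv.swap_mul_swap_mul_swap hbc.symm hac.symm, Equiv.swap_comm]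

theorem cyc_self (n v : ℕ) : cyc n v v = 1 := by
  simp [cyc]

theorem cyc_eq_mul (n : ℕ) {v w : ℕ} (h : v < w) :
    cyc n v w = simpleTransposition n v * cyc n (v + 1) w := by
  obtain ⟨d, rfl⟩ := Nat.exists_eq_add_of_lt h
  simp only [cyc, show v + d + 1 - v = d + 1 by omega, show v + d + 1 - (v + 1) = d by omega,
    List.range'_succ, List.map_cons, List.prod_cons]

theorem simpleTransposition_commute_cyc (n w : ℕ) {i v : ℕ} (h : i + 2 ≤ v) :
    Commute (simpleTransposition n i) (cyc n v w) := by
  refine Commute.list_prod_right _ _ fun x hx => ?_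
  obtain ⟨j, hj, rfl⟩ := List.mem_map.1 hx
  exact simpleTransposition_commute n (h.trans (List.mem_range'_1.1 hj).1)

theorem mul_mul_one_add_mul_eq_of_braid {A : Type*} [Ring A] {s r T U : A} (hs : s * s = 1)
    (hsr : s * r * s = r * s * r) (hsU : Commute s U) (hT : T = 1 + r * U)
    (hUT : r * (U * T) = U * T) :
    s * (T * (1 + s * T)) = T * (1 + s * T) := by
  have expand : T * (1 + s * T) = T + s * T + r * s * (U * T) := by
    calc T * (1 + s * T) = T + (1 + r * U) * (s * T) := by rw [← hT]; noncomm_ring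
      _ = T + s * T + r * (U * s) * T := by noncomm_ring
      _ = _ := by rw [← hsU.eq]; noncomm_ring
  have invariant : s * (r * s * (U * T)) = r * s * (U * T) := by
    calc s * (r * s * (U * T)) = s * r * s * (U * T) := by noncomm_ring
      _ = r * s * (r * (U * T)) := by rw [hsr]; noncomm_ring
      _ = _ := by rw [hUT]
  rw [expand, mul_add, mul_add, invariant, ← mul_assoc s s, hs, one_mul, add_comm (s * T)]

section Shuffle

variable (R : Type*) [CommRing R] (n : ℕ)

theorem t_eq_one_add {l : ℕ} (h : l ≤ n) :
    t R n l = 1 + MonoidAlgebra.of R _ (simpleTransposition n l) * t R n (l + 1) := by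
  rw [t, t, ← Finset.insert_Icc_add_one_left_eq_Icc h, Finset.sum_insert (by simp), cyc_self,
    map_one, Finset.mul_sum]
  congr 1
  refine Finset.sum_congr rfl fun w hw => ?_
  rw [cyc_eq_mul n (Finset.mem_Icc.1 hw).1, map_mul]

theorem t_succ_self : t R n (n + 1) = 0 := by
  simp [t]

theorem simpleTransposition_commute_t {i l : ℕ} (h : i + 2 ≤ l) :
    Commute (MonoidAlgebra.of R _ (simpleTransposition n i)) (t R n l) :=
  Commute.sum_right _ _ _ fun w _ => (simpleTransposition_commute_cyc n w h).map _

theorem simpleTransposition_mul_t_succ_mul_t {l : ℕ} (hl : 1 ≤ l) (hln : l ≤ n) :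
    MonoidAlgebra.of R _ (simpleTransposition n l) * (t R n (l + 1) * t R n l) =
      t R n (l + 1) * t R n l := by
  induction hln using Nat.decreasingInduction with
  | self => simp [t_succ_self]
  | of_succ l hln ih =>
    have hT := t_eq_one_add R n (Nat.succ_le_of_lt hln)
    have hs : MonoidAlgebra.of R _ (simpleTransposition n l) *
        MonoidAlgebra.of R _ (simpleTransposition n l) = 1 := by
      rw [← map_mul, simpleTransposition_mul_self, map_one]
    rw [t_eq_one_add R n hln.le]
    rcases (Nat.succ_le_of_lt hln).eq_or_lt with rfl | hln'
    · rw [hT, t_succ_self, mul_zero, add_zero, one_mul, mul_one, mul_add, hs, mul_one, add_comm]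
    · refine mul_mul_one_add_mul_eq_of_braid hs ?_
        (simpleTransposition_commute_t R n le_rfl) hT (ih (Nat.le_add_left 1 l))
      simp only [← map_mul, simpleTransposition_braid n hl hln']

end Shuffle

theorem ti_plus_two_mul_ti_sub_one
    (R : Type*) [CommRing R] (n : ℕ) (hn : 0 < n)
    (i : ℕ) (hi1 : 1 ≤ i) (hin : i ≤ n - 2) :
    t R n (i + 2) * (t R n i - 1) = (t R n i - 1) * (t R n (i + 1) - 1) := by
  have h1 := t_eq_one_add R n (show i ≤ n by omega)
  have h2 := t_eq_one_add R n (show i + 1 ≤ n by omega)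
  have hc := (simpleTransposition_commute_t R n (le_refl (i + 2))).eq
  have hinv := simpleTransposition_mul_t_succ_mul_t R n (show 1 ≤ i + 1 by omega) (by omega)
  have key : t R n (i + 2) * t R n (i + 1) = t R n (i + 1) * (t R n (i + 1) - 1) := by
    calc t R n (i + 2) * t R n (i + 1) = (t R n (i + 1) - 1) * t R n (i + 1) := by
          rw [← hinv, ← mul_assoc]
          congr 1
          rw [h2]; abel
      _ = _ := by noncomm_ring
  rw [h1, add_sub_cancel_left, ← mul_assoc, ← hc, mul_assoc, key, mul_assoc]
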